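/- arXiv:1302.3931 — 4 statements merged into one kernel-verified Lean document; each statement's English description precedes it below -/
import Mathlib

section
/- Let p be a strictly positive distribution on {0,1}^n. Let G_θ be the matrix indexed by nonempty subsets I, J ⊆ {1,…,n} with entries g_{IJ} = η_{I∪J} − η_I η_J, and let G_η be the matrix with entries g^{IJ} = Σ_{K ⊆ I∩J} (−1)^{|I∖K|+|J∖K|} · (1/p_K), where the sum runs over all K ⊆ I∩J including K = ∅. Then G_η is the inverse matrix of G_θ, i.e., Σ_J g^{IJ} g_{JK} = δ^I_K; in particular G_η is the Fisher information matrix of the η-coordinates. -/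
/-!
STATEMENT 1: the matrix `G_η` with entries
`g^{IJ} = Σ_{K ⊆ I∩J} (−1)^{|I∖K|+|J∖K|} / p_K` is the inverse of the matrix
`G_θ` with entries `g_{IJ} = η_{I∪J} − η_I η_J`, both indexed by nonempty
subsets of `{1,…,n}`.  States of `{0,1}^n` are identified with `Finset (Fin n)`.
-/

open Finset

namespace Stmt1

variable (n : ℕ)

/-- η-coordinates: `η_I = Σ_{J ⊇ I} p_J` (so `η_∅ = 1` when `p` sums to one). -/
noncomputable def η (p : Finset (Fin n) → ℝ) (I : Finset (Fin n)) : ℝ :=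
  ∑ J ∈ Finset.univ.filter (fun J : Finset (Fin n) => I ⊆ J), p J

/-- Fisher information of the θ-coordinates: `g_{IJ} = η_{I∪J} − η_I η_J`. -/
noncomputable def gTheta (p : Finset (Fin n) → ℝ) (I J : Finset (Fin n)) : ℝ :=
  η n p (I ∪ J) - η n p I * η n p J

/-- Fisher information of the η-coordinates:
`g^{IJ} = Σ_{K ⊆ I∩J} (−1)^{|I∖K|+|J∖K|} · (1/p_K)`, sum including `K = ∅`. -/
noncomputable def gEta (p : Finset (Fin n) → ℝ) (I J : Finset (Fin n)) : ℝ :=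
  ∑ K ∈ (I ∩ J).powerset, (-1 : ℝ) ^ ((I \ K).card + (J \ K).card) * (1 / p K)

/-- The signed count of the interval `[A, B]`, graded from below, vanishes unless `A = B`. -/
theorem sum_Icc_neg_one_pow_card_sdiff_left {α : Type*} [DecidableEq α] (A B : Finset α) :
    ∑ L ∈ Finset.Icc A B, (-1 : ℝ) ^ (L \ A).card = if A = B then 1 else 0 := by
  by_cases h : A ⊆ B
  · rw [Finset.Icc_eq_image_powerset h, Finset.sum_image]
    · have key : ∀ M ∈ (B \ A).powerset,
          (-1 : ℝ) ^ ((A ∪ M) \ A).card = (((-1 : ℤ) ^ M.card : ℤ) : ℝ) := by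
        intro M hM
        have hd : Disjoint M A :=
          Finset.disjoint_of_subset_left (Finset.mem_powerset.mp hM) Finset.sdiff_disjoint
        rw [Finset.union_sdiff_left, Finset.sdiff_eq_self_of_disjoint hd]
        push_cast
        rfl
      rw [Finset.sum_congr rfl key, ← Int.cast_sum, Finset.sum_powerset_neg_one_pow_card]
      have hiff : B \ A = ∅ ↔ A = B := by
        rw [Finset.sdiff_eq_empty_iff_subset]
        exact ⟨fun h' => h.antisymm h', fun h' => h' ▸ Finset.Subset.refl _⟩
      simp [hiff]
    · intro M hM N hN hMN
      have hM' : Disjoint M A :=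
        Finset.disjoint_of_subset_left (Finset.mem_powerset.mp hM) Finset.sdiff_disjoint
      have hN' : Disjoint N A :=
        Finset.disjoint_of_subset_left (Finset.mem_powerset.mp hN) Finset.sdiff_disjoint
      have hsd := congrArg (· \ A) hMN
      simpa [Finset.union_sdiff_left, Finset.sdiff_eq_self_of_disjoint hM',
        Finset.sdiff_eq_self_of_disjoint hN'] using hsd
  · rw [Finset.Icc_eq_empty h, Finset.sum_empty, if_neg]
    rintro rfl
    exact h (Finset.Subset.refl _)

/-- The signed count of the interval `[A, B]`, graded from above, vanishes unless `A = B`. -/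
theorem sum_Icc_neg_one_pow_card_sdiff_right {α : Type*} [DecidableEq α] (A B : Finset α) :
    ∑ L ∈ Finset.Icc A B, (-1 : ℝ) ^ (B \ L).card = if A = B then 1 else 0 := by
  have key : ∀ L ∈ Finset.Icc A B,
      (-1 : ℝ) ^ (B \ L).card = (-1) ^ (B \ A).card * (-1) ^ (L \ A).card := by
    intro L hL
    obtain ⟨hAL, hLB⟩ := Finset.mem_Icc.mp hL
    have hcard : (B \ A).card = (B \ L).card + (L \ A).card := by
      have h₁ := Finset.card_sdiff_add_card_eq_card hAL
      have h₂ := Finset.card_sdiff_add_card_eq_card hLB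
      have h₃ := Finset.card_sdiff_add_card_eq_card (hAL.trans hLB)
      omega
    rw [hcard, pow_add, mul_assoc, ← mul_pow]
    simp
  rw [Finset.sum_congr rfl key, ← Finset.mul_sum, sum_Icc_neg_one_pow_card_sdiff_left]
  split_ifs with h
  · simp [h]
  · simp

/-- Möbius inversion over supersets. -/
theorem sum_superset_neg_one_pow_mul_sum_superset {α : Type*} [Fintype α] [DecidableEq α]
    (h : Finset α → ℝ) (L : Finset α) :
    ∑ J with L ⊆ J, (-1 : ℝ) ^ (J \ L).card * ∑ M with J ⊆ M, h M = h L := by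
  simp_rw [Finset.mul_sum]
  rw [Finset.sum_comm' (t' := Finset.univ) (s' := fun M => Finset.Icc L M)
    (by intro J M; simp)]
  simp_rw [← Finset.sum_mul, sum_Icc_neg_one_pow_card_sdiff_left]
  simp

theorem gTheta_eq_sum (p : Finset (Fin n) → ℝ) (J K : Finset (Fin n)) :
    gTheta n p J K = ∑ M with J ⊆ M, p M * ((if K ⊆ M then 1 else 0) - η n p K) := by
  simp_rw [mul_sub, Finset.sum_sub_distrib, ← Finset.sum_mul, mul_ite, mul_one, mul_zero]
  rw [← Finset.sum_filter, Finset.filter_filter]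
  simp only [gTheta, η, Finset.union_subset_iff]

theorem gTheta_empty_left (p : Finset (Fin n) → ℝ) (hsum : ∑ x : Finset (Fin n), p x = 1)
    (K : Finset (Fin n)) : gTheta n p ∅ K = 0 := by
  simp [gTheta, η, hsum]

/-- Proposition 2 of the paper: `Σ_J g^{IJ} g_{JK} = δ^I_K`, i.e. `G_η = G_θ⁻¹`. -/
theorem gEta_inverse_gTheta (hn : 1 ≤ n) (p : Finset (Fin n) → ℝ)
    (hpos : ∀ x, 0 < p x) (hsum : ∑ x : Finset (Fin n), p x = 1)
    (I K : Finset (Fin n)) (hI : I ≠ ∅) (hK : K ≠ ∅) :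
    ∑ J ∈ Finset.univ.filter (fun J : Finset (Fin n) => J ≠ ∅),
      gEta n p I J * gTheta n p J K = if I = K then 1 else 0 := by
  have hJ : ∀ J ∈ (Finset.univ : Finset (Finset (Fin n))),
      gEta n p I J * gTheta n p J K ≠ 0 → J ≠ ∅ := by
    rintro J - hne rfl
    exact hne (by rw [gTheta_empty_left n p hsum, mul_zero])
  rw [Finset.sum_filter_of_ne hJ]
  simp_rw [gEta, Finset.sum_mul]
  rw [Finset.sum_comm' (t' := I.powerset) (s' := fun L => Finset.univ.filter (L ⊆ ·))
    (by intro J L; simp [-Finset.powerset_inter, Finset.mem_powerset, Finset.subset_inter_iff, and_comm])]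
  have hinner : ∀ L ∈ I.powerset,
      ∑ J with L ⊆ J, (-1 : ℝ) ^ ((I \ L).card + (J \ L).card) * (1 / p L) * gTheta n p J K =
        (if K ⊆ L then (-1 : ℝ) ^ (I \ L).card else 0) - (-1) ^ (I \ L).card * η n p K := by
    intro L _
    calc _ = (-1 : ℝ) ^ (I \ L).card * (1 / p L) *
          ∑ J with L ⊆ J, (-1 : ℝ) ^ (J \ L).card *
            ∑ M with J ⊆ M, p M * ((if K ⊆ M then 1 else 0) - η n p K) := by
          rw [Finset.mul_sum]
          refine Finset.sum_congr rfl fun J _ => ?_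
          rw [gTheta_eq_sum, pow_add]
          ring
      _ = _ := by
          rw [sum_superset_neg_one_pow_mul_sum_superset
            (fun M => p M * ((if K ⊆ M then 1 else 0) - η n p K))]
          have hp := (hpos L).ne'
          split_ifs <;> field_simp <;> ring
  have hIcc : I.powerset.filter (K ⊆ ·) = Finset.Icc K I := by
    ext L
    simp [and_comm]
  have hIcc_empty : I.powerset = Finset.Icc ∅ I := by
    ext L
    simp
  rw [Finset.sum_congr rfl hinner, Finset.sum_sub_distrib, ← Finset.sum_filter, hIcc,
    ← Finset.sum_mul, hIcc_empty, sum_Icc_neg_one_pow_card_sdiff_right,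
    sum_Icc_neg_one_pow_card_sdiff_right]
  simp [hI.symm, eq_comm]

end Stmt1
end

section
/- Let H be an l×l real symmetric positive definite matrix and let i ∈ {1,…,l}. If H_{ii} < 1, then (H^{−1})_{ii} > 1. -/
open Matrix

/-- For a positive definite matrix `H`, the matrix `H + H⁻¹ - 2` is positive semidefinite. -/
theorem Matrix.PosDef.posSemidef_add_inv_sub_two {n : Type*} [Fintype n] [DecidableEq n]
    {H : Matrix n n ℝ} (hH : H.PosDef) : (H + H⁻¹ - (1 + 1)).PosSemidef := by
  have hdet : IsUnit H.det := (isUnit_iff_isUnit_det H).mp hH.isUnit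
  have h := hH.posSemidef.conjTranspose_mul_mul_same (1 - H⁻¹)
  have hinv : (H⁻¹)ᴴ = H⁻¹ := hH.inv.isHermitian
  have heq : (1 - H⁻¹)ᴴ * H * (1 - H⁻¹) = H + H⁻¹ - (1 + 1) := by
    rw [conjTranspose_sub, hinv, conjTranspose_one, sub_mul, nonsing_inv_mul H hdet, one_mul,
      mul_sub, sub_mul, sub_mul, mul_nonsing_inv H hdet]
    simp only [mul_one, one_mul]
    abel
  rwa [heq] at h

theorem inv_diag_gt_one (l : ℕ) (H : Matrix (Fin l) (Fin l) ℝ)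
    (hsymm : H.IsSymm) (hpd : H.PosDef)
    (i : Fin l) (hii : H i i < 1) :
    1 < H⁻¹ i i := by
  have h := hpd.posSemidef_add_inv_sub_two.diag_nonneg (i := i)
  simp only [Matrix.sub_apply, Matrix.add_apply, one_apply_eq] at h
  linarith
end

section
/- Consider strictly positive distributions on {0,1}^{n_x} × {0,1}^{n_h}, with variables partitioned into visible x_1,…,x_{n_x} and hidden h_1,…,h_{n_h}. The fractional mixed coordinate map, which assigns to each such distribution p the tuple consisting of: the first-order η-coordinates η_{x_i}, η_{h_j}; the second-order θ-coordinates θ^{x_i x_j} (visible–visible) and θ^{h_i h_j} (hidden–hidden); the second-order η-coordinates η_{x_i h_j} (visible–hidden); and all θ-coordinates θ^I for index sets I of cardinality at least 3 — where η_I = E_p[∏_{v∈I} v] and θ^I = Σ_{K⊆I} (−1)^{|I∖K|} log p_K — is injective: two strictly positive distributions with the same fractional mixed coordinates are equal. -/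
/-!
STATEMENT 16 (Proposition 8 of the paper): the fractional mixed coordinate map
is injective on strictly positive distributions over
`{0,1}^{n_x} × {0,1}^{n_h}`.  Variables are indexed by `Fin nx ⊕ Fin nh`
(left = visible, right = hidden) and a binary state is identified with the set
of indices equal to one, i.e. with `Finset (Fin nx ⊕ Fin nh)`.
-/

open Finset

namespace Stmt16

variable (nx nh : ℕ)

/-- η-coordinates: `η_I = Σ_{J ⊇ I} p_J = E_p[∏_{v∈I} v]`. -/
noncomputable def η (p : Finset (Fin nx ⊕ Fin nh) → ℝ)
    (I : Finset (Fin nx ⊕ Fin nh)) : ℝ :=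
  ∑ J ∈ Finset.univ.filter (fun J : Finset (Fin nx ⊕ Fin nh) => I ⊆ J), p J

/-- θ-coordinates: `θ^I = Σ_{K⊆I} (−1)^{|I∖K|} log p_K`. -/
noncomputable def θ (p : Finset (Fin nx ⊕ Fin nh) → ℝ)
    (I : Finset (Fin nx ⊕ Fin nh)) : ℝ :=
  ∑ K ∈ I.powerset, (-1 : ℝ) ^ ((I \ K).card) * Real.log (p K)

/-- Möbius inversion over the Boolean lattice of subsets of a finite set. -/
theorem sum_powerset_sum_neg_one_pow_card_sdiff_mul {α R : Type*} [DecidableEq α] [CommRing R]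
    (f : Finset α → R) (J : Finset α) :
    ∑ I ∈ J.powerset, ∑ K ∈ I.powerset, (-1 : R) ^ (I \ K).card * f K = f J := by
  induction J using Finset.induction_on generalizing f with
  | empty => simp
  | insert a J ha ih =>
    have key : ∀ I ∈ J.powerset,
        ∑ K ∈ (insert a I).powerset, (-1 : R) ^ (insert a I \ K).card * f K =
          -(∑ K ∈ I.powerset, (-1 : R) ^ (I \ K).card * f K) +
            ∑ K ∈ I.powerset, (-1 : R) ^ (I \ K).card * f (insert a K) := by
      intro I hI
      have haI : a ∉ I := fun h => ha (mem_powerset.1 hI h)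
      rw [sum_powerset_insert haI, ← sum_neg_distrib]
      congr 1 <;> refine sum_congr rfl fun K hK => ?_
      · have haK : a ∉ K := fun h => haI (mem_powerset.1 hK h)
        rw [insert_sdiff_of_notMem _ haK, card_insert_of_notMem (by simp [haI]), pow_succ]
        ring
      · rw [insert_sdiff_insert, sdiff_insert_of_notMem haI]
    rw [sum_powerset_insert ha, sum_congr rfl key, sum_add_distrib, sum_neg_distrib,
      ih fun K => f (insert a K)]
    ring

/-- The log-probabilities are recovered by summing θ-coordinates over subsets. -/
theorem sum_powerset_θ (p : Finset (Fin nx ⊕ Fin nh) → ℝ) (J : Finset (Fin nx ⊕ Fin nh)) :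
    ∑ I ∈ J.powerset, θ nx nh p I = Real.log (p J) :=
  sum_powerset_sum_neg_one_pow_card_sdiff_mul (fun K => Real.log (p K)) J

/-- The pairing of `q` with log-probabilities is the pairing of its η-coordinates with the
θ-coordinates. -/
theorem sum_mul_log_eq_sum_η_mul_θ (p q : Finset (Fin nx ⊕ Fin nh) → ℝ) :
    ∑ J, q J * Real.log (p J) = ∑ I, η nx nh q I * θ nx nh p I := by
  simp_rw [← sum_powerset_θ, η, mul_sum, sum_mul]
  exact sum_comm' (by simp)

/-- The symmetrized Kullback–Leibler divergence, expressed through dual coordinates. -/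
theorem sum_sub_mul_log_sub_log (p q : Finset (Fin nx ⊕ Fin nh) → ℝ) :
    ∑ J, (p J - q J) * (Real.log (p J) - Real.log (q J)) =
      ∑ I, (η nx nh p I - η nx nh q I) * (θ nx nh p I - θ nx nh q I) := by
  simp only [sub_mul, mul_sub, sum_sub_distrib, sum_mul_log_eq_sum_η_mul_θ]

/-- Strictly positive distributions are equal if for every index set either their η-coordinates
or their θ-coordinates agree. -/
theorem eq_of_η_eq_or_θ_eq (p q : Finset (Fin nx ⊕ Fin nh) → ℝ)
    (hp : ∀ x, 0 < p x) (hq : ∀ x, 0 < q x)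
    (h : ∀ I, η nx nh p I = η nx nh q I ∨ θ nx nh p I = θ nx nh q I) : p = q := by
  have hzero : ∑ J, (p J - q J) * (Real.log (p J) - Real.log (q J)) = 0 := by
    rw [sum_sub_mul_log_sub_log]
    refine sum_eq_zero fun I _ => ?_
    rcases h I with h | h <;> simp [h]
  have hnonneg : ∀ J ∈ univ, 0 ≤ (p J - q J) * (Real.log (p J) - Real.log (q J)) := by
    intro J _
    rcases le_total (p J) (q J) with hle | hle
    · exact mul_nonneg_of_nonpos_of_nonpos (sub_nonpos.2 hle)
        (sub_nonpos.2 (Real.log_le_log (hp J) hle))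
    · exact mul_nonneg (sub_nonneg.2 hle) (sub_nonneg.2 (Real.log_le_log (hq J) hle))
  funext J
  rcases mul_eq_zero.1 ((sum_eq_zero_iff_of_nonneg hnonneg).1 hzero J (mem_univ J)) with h | h
  · exact sub_eq_zero.1 h
  · exact Real.log_injOn_pos (hp J) (hq J) (sub_eq_zero.1 h)

theorem fractional_mixed_coordinates_injective
    (p₁ p₂ : Finset (Fin nx ⊕ Fin nh) → ℝ)
    (hpos₁ : ∀ x, 0 < p₁ x) (hsum₁ : ∑ x : Finset (Fin nx ⊕ Fin nh), p₁ x = 1)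
    (hpos₂ : ∀ x, 0 < p₂ x) (hsum₂ : ∑ x : Finset (Fin nx ⊕ Fin nh), p₂ x = 1)
    -- first-order η-coordinates agree
    (h1 : ∀ a : Fin nx ⊕ Fin nh, η nx nh p₁ {a} = η nx nh p₂ {a})
    -- second-order visible–visible θ-coordinates agree
    (h2 : ∀ i j : Fin nx, i ≠ j →
      θ nx nh p₁ {Sum.inl i, Sum.inl j} = θ nx nh p₂ {Sum.inl i, Sum.inl j})
    -- second-order hidden–hidden θ-coordinates agree
    (h3 : ∀ i j : Fin nh, i ≠ j →
      θ nx nh p₁ {Sum.inr i, Sum.inr j} = θ nx nh p₂ {Sum.inr i, Sum.inr j})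
    -- second-order visible–hidden η-coordinates agree
    (h4 : ∀ (i : Fin nx) (j : Fin nh),
      η nx nh p₁ {Sum.inl i, Sum.inr j} = η nx nh p₂ {Sum.inl i, Sum.inr j})
    -- all θ-coordinates of order at least 3 agree
    (h5 : ∀ I : Finset (Fin nx ⊕ Fin nh), 3 ≤ I.card →
      θ nx nh p₁ I = θ nx nh p₂ I) :
    p₁ = p₂ := by
  refine eq_of_η_eq_or_θ_eq nx nh p₁ p₂ hpos₁ hpos₂ fun I => ?_
  rcases le_or_gt 3 I.card with hI | hI
  · exact .inr (h5 I hI)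
  have hcard : I.card = 0 ∨ I.card = 1 ∨ I.card = 2 := by omega
  rcases hcard with hI | hI | hI
  · left
    simp [card_eq_zero.1 hI, η, hsum₁, hsum₂]
  · obtain ⟨a, rfl⟩ := card_eq_one.1 hI
    exact .inl (h1 a)
  · obtain ⟨a, b, hab, rfl⟩ := card_eq_two.1 hI
    rcases a with i | i <;> rcases b with j | j
    · exact .inr (h2 i j fun h => hab (h ▸ rfl))
    · exact .inl (h4 i j)
    · rw [pair_comm]
      exact .inl (h4 j i)
    · exact .inr (h3 i j fun h => hab (h ▸ rfl))

end Stmt16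
end

section
/- Let p be a strictly positive distribution on {0,1}^{n_x} × {0,1}^{n_h} with variables partitioned into visible x_1,…,x_{n_x} and hidden h_1,…,h_{n_h}, and let θ^I = Σ_{K⊆I} (−1)^{|I∖K|} log p_K be its θ-coordinates. Then the visible variables are mutually conditionally independent given the hidden variables (i.e., p(x|h) = ∏_i p(x_i|h) for every h) if and only if θ^I = 0 for every index set I containing at least two visible variables. Symmetrically, the hidden variables are mutually conditionally independent given the visible variables if and only if θ^I = 0 for every index set I containing at least two hidden variables. -/
/-!
STATEMENT 17 (completeness and compactness conditions of Section 4.3.1):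
for a strictly positive distribution on `{0,1}^{n_x} × {0,1}^{n_h}`, the
visible variables are mutually conditionally independent given the hidden ones
iff `θ^I = 0` for every index set `I` containing at least two visible
variables; and symmetrically for the hidden variables.  Variables are indexed
by `Fin nx ⊕ Fin nh` (left = visible, right = hidden) and a state is the set
of indices equal to one.
-/

open Finset

namespace Stmt17

variable (nx nh : ℕ)

/-- Joint state determined by the set of visible units and hidden units on. -/
def state (vs : Finset (Fin nx)) (hs : Finset (Fin nh)) : Finset (Fin nx ⊕ Fin nh) :=
  vs.image Sum.inl ∪ hs.image Sum.inr

/-- θ-coordinates: `θ^I = Σ_{K⊆I} (−1)^{|I∖K|} log p_K`. -/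
noncomputable def θ (p : Finset (Fin nx ⊕ Fin nh) → ℝ)
    (I : Finset (Fin nx ⊕ Fin nh)) : ℝ :=
  ∑ K ∈ I.powerset, (-1 : ℝ) ^ ((I \ K).card) * Real.log (p K)

/-- Conditional probability `p(x = vs | h = hs)` of a visible configuration. -/
noncomputable def condVis (p : Finset (Fin nx ⊕ Fin nh) → ℝ)
    (vs : Finset (Fin nx)) (hs : Finset (Fin nh)) : ℝ :=
  p (state nx nh vs hs) / ∑ vs' : Finset (Fin nx), p (state nx nh vs' hs)

/-- Conditional probability `p(x_i = 1 | h = hs)`. -/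
noncomputable def condVisOne (p : Finset (Fin nx ⊕ Fin nh) → ℝ)
    (i : Fin nx) (hs : Finset (Fin nh)) : ℝ :=
  (∑ vs ∈ Finset.univ.filter (fun vs : Finset (Fin nx) => i ∈ vs),
    p (state nx nh vs hs)) / ∑ vs' : Finset (Fin nx), p (state nx nh vs' hs)

/-- Conditional probability `p(h = hs | x = vs)` of a hidden configuration. -/
noncomputable def condHid (p : Finset (Fin nx ⊕ Fin nh) → ℝ)
    (hs : Finset (Fin nh)) (vs : Finset (Fin nx)) : ℝ :=
  p (state nx nh vs hs) / ∑ hs' : Finset (Fin nh), p (state nx nh vs hs')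

/-- Conditional probability `p(h_j = 1 | x = vs)`. -/
noncomputable def condHidOne (p : Finset (Fin nx ⊕ Fin nh) → ℝ)
    (j : Fin nh) (vs : Finset (Fin nx)) : ℝ :=
  (∑ hs ∈ Finset.univ.filter (fun hs : Finset (Fin nh) => j ∈ hs),
    p (state nx nh vs hs)) / ∑ hs' : Finset (Fin nh), p (state nx nh vs hs')

/-- The Möbius transform on the lattice of finite subsets. -/
noncomputable def moebius {α : Type*} [DecidableEq α] (f : Finset α → ℝ) (S : Finset α) : ℝ :=
  ∑ J ∈ S.powerset, (-1 : ℝ) ^ (S \ J).card * f J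

theorem moebius_insert {α : Type*} [DecidableEq α] (f : Finset α → ℝ) {a : α} {S : Finset α}
    (ha : a ∉ S) :
    moebius f (insert a S) = moebius (fun J => f (insert a J)) S - moebius f S := by
  unfold moebius
  rw [Finset.sum_powerset_insert ha, add_comm, sub_eq_add_neg, ← Finset.sum_neg_distrib]
  congr 1
  · refine Finset.sum_congr rfl fun J _ => ?_
    rw [Finset.insert_sdiff_insert, Finset.sdiff_insert_of_notMem ha]
  · refine Finset.sum_congr rfl fun J hJ => ?_
    have haJ : a ∉ J := fun h => ha (Finset.mem_powerset.1 hJ h)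
    rw [Finset.insert_sdiff_of_notMem _ haJ,
      Finset.card_insert_of_notMem (by simp [ha]), pow_succ]
    ring

theorem sum_powerset_moebius {α : Type*} [DecidableEq α] (S : Finset α) (f : Finset α → ℝ) :
    ∑ J ∈ S.powerset, moebius f J = f S := by
  induction S using Finset.induction_on generalizing f with
  | empty => simp [moebius]
  | insert a S ha ih =>
    have h : ∀ J ∈ S.powerset, moebius f (insert a J)
        = moebius (fun J => f (insert a J)) J - moebius f J := fun J hJ =>
      moebius_insert f fun h => ha (Finset.mem_powerset.1 hJ h)
    rw [Finset.sum_powerset_insert ha, Finset.sum_congr rfl h, Finset.sum_sub_distrib, ih, ih]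
    ring

theorem forall_moebius_eq_zero_iff {α : Type*} [DecidableEq α] (f : Finset α → ℝ) :
    (∀ S, moebius f S = 0) ↔ ∀ S, f S = 0 := by
  refine ⟨fun h S => ?_, fun h S => ?_⟩
  · rw [← sum_powerset_moebius S f, Finset.sum_eq_zero fun J _ => h J]
  · simp [moebius, h]

/-- A set function is affine iff its Möbius transform vanishes in degree at least two. -/
theorem affine_iff_moebius_eq_zero {α : Type*} [DecidableEq α] (f : Finset α → ℝ) :
    (∃ (c : ℝ) (w : α → ℝ), ∀ S, f S = c + ∑ i ∈ S, w i) ↔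
      ∀ S : Finset α, 2 ≤ S.card → moebius f S = 0 := by
  constructor
  · rintro ⟨c, w, hf⟩ S hS
    obtain ⟨a, ha, b, hb, hab⟩ := Finset.one_lt_card.1 hS
    obtain ⟨R, haR, rfl⟩ : ∃ R, a ∉ R ∧ insert a R = S :=
      ⟨S.erase a, Finset.notMem_erase a S, Finset.insert_erase ha⟩
    have hbR : b ∈ R := (Finset.mem_insert.1 hb).resolve_left hab.symm
    obtain ⟨Q, hbQ, rfl⟩ : ∃ Q, b ∉ Q ∧ insert b Q = R :=
      ⟨R.erase b, Finset.notMem_erase b R, Finset.insert_erase hbR⟩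
    rw [moebius_insert f haR, moebius_insert _ hbQ, moebius_insert _ hbQ]
    unfold moebius
    rw [← Finset.sum_sub_distrib, ← Finset.sum_sub_distrib, ← Finset.sum_sub_distrib]
    refine Finset.sum_eq_zero fun J hJ => ?_
    have hJQ := Finset.mem_powerset.1 hJ
    have hbJ : b ∉ J := fun h => hbQ (hJQ h)
    have haJ : a ∉ J := fun h => haR (Finset.mem_insert_of_mem (hJQ h))
    have habJ : a ∉ insert b J := by simp [hab, haJ]
    simp only [hf, Finset.sum_insert habJ, Finset.sum_insert hbJ, Finset.sum_insert haJ]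
    ring
  · intro h
    refine ⟨f ∅, fun i => moebius f {i}, fun S => ?_⟩
    induction S using Finset.induction_on with
    | empty => simp
    | insert a S ha ih =>
      have hsum : ∑ J ∈ S.powerset, moebius f (insert a J) = moebius f {a} := by
        rw [Finset.sum_eq_single_of_mem ∅ (Finset.empty_mem_powerset S)]
        · simp
        · intro J hJ hne
          apply h
          have haJ : a ∉ J := fun h => ha (Finset.mem_powerset.1 hJ h)
          have := Finset.card_pos.2 (Finset.nonempty_iff_ne_empty.2 hne)
          rw [Finset.card_insert_of_notMem haJ]
          omega
      rw [← sum_powerset_moebius (insert a S) f, Finset.sum_powerset_insert ha, sum_powerset_moebius, hsum, ih,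
        Finset.sum_insert ha]
      ring

/-- A positive weight on subsets is a product of its one-variable marginals iff its logarithm is
affine. -/
theorem eq_prod_marginals_iff_log_affine {α : Type*} [Fintype α] [DecidableEq α]
    (q : Finset α → ℝ) (hq : ∀ s, 0 < q s) :
    (∀ s, q s / ∑ t, q t = ∏ i, if i ∈ s
        then (∑ t ∈ Finset.univ.filter (fun t : Finset α => i ∈ t), q t) / ∑ t, q t
        else 1 - (∑ t ∈ Finset.univ.filter (fun t : Finset α => i ∈ t), q t) / ∑ t, q t) ↔
      ∃ (c : ℝ) (w : α → ℝ), ∀ s, Real.log (q s) = c + ∑ i ∈ s, w i := by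
  have hZ : 0 < ∑ t, q t := Finset.sum_pos (fun t _ => hq t) Finset.univ_nonempty
  constructor
  · obtain ⟨m, hm⟩ : ∃ m : α → ℝ, ∀ i,
        (∑ t ∈ Finset.univ.filter (fun t : Finset α => i ∈ t), q t) / ∑ t, q t = m i :=
      ⟨_, fun _ => rfl⟩
    simp only [hm]
    intro h
    have hne : ∀ s i, (if i ∈ s then m i else 1 - m i) ≠ 0 := fun s i =>
      Finset.prod_ne_zero_iff.1 ((h s).symm ▸ (div_pos (hq s) hZ).ne') i (Finset.mem_univ i)
    refine ⟨Real.log (∑ t, q t) + ∑ i, Real.log (1 - m i),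
      fun i => Real.log (m i) - Real.log (1 - m i), fun s => ?_⟩
    have hlog := congrArg Real.log (h s)
    rw [Real.log_div (hq s).ne' hZ.ne', Real.log_prod (fun i _ => hne s i)] at hlog
    have hsplit : ∑ i, Real.log (if i ∈ s then m i else 1 - m i)
        = ∑ i, Real.log (1 - m i) + ∑ i ∈ s, (Real.log (m i) - Real.log (1 - m i)) := by
      rw [← Finset.univ_inter s, ← Finset.sum_ite_mem, ← Finset.sum_add_distrib]
      refine Finset.sum_congr rfl fun i _ => ?_
      simp only [Finset.univ_inter]
      split_ifs <;> ring
    linarith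
  · rintro ⟨c, w, h⟩ s
    have hqe : ∀ t, q t = Real.exp c * ∏ i ∈ t, Real.exp (w i) := fun t => by
      rw [← Real.exp_log (hq t), h, Real.exp_add, Real.exp_sum]
    have hpos : ∀ i, 0 < 1 + Real.exp (w i) := fun i => by positivity
    have hZe : ∑ t, q t = Real.exp c * ∏ i, (1 + Real.exp (w i)) := by
      simp only [hqe]
      rw [← Finset.mul_sum, Finset.prod_one_add, Finset.powerset_univ]
    have hmarg : ∀ i, (∑ t ∈ Finset.univ.filter (fun t : Finset α => i ∈ t), q t) / ∑ t, q t
        = Real.exp (w i) / (1 + Real.exp (w i)) := by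
      intro i
      have hu : insert i (Finset.univ.erase i) = (Finset.univ : Finset α) :=
        Finset.insert_erase (Finset.mem_univ i)
      have hi : i ∉ (Finset.univ.erase i : Finset α) := Finset.notMem_erase i _
      have hnum : ∑ t ∈ Finset.univ.filter (fun t : Finset α => i ∈ t), q t
          = Real.exp c * (Real.exp (w i) * ∏ j ∈ Finset.univ.erase i, (1 + Real.exp (w j))) := by
        rw [Finset.sum_filter, ← Finset.powerset_univ]
        conv_lhs => rw [← hu]
        rw [Finset.sum_powerset_insert hi, Finset.prod_one_add, Finset.mul_sum, Finset.mul_sum,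
          Finset.sum_eq_zero, zero_add]
        · refine Finset.sum_congr rfl fun J hJ => ?_
          have hiJ : i ∉ J := fun h => hi (Finset.mem_powerset.1 hJ h)
          rw [if_pos (Finset.mem_insert_self i J), hqe, Finset.prod_insert hiJ]
        · intro J hJ
          rw [if_neg fun h => hi (Finset.mem_powerset.1 hJ h)]
      have hden : ∑ t, q t = Real.exp c * ((1 + Real.exp (w i)) *
          ∏ j ∈ Finset.univ.erase i, (1 + Real.exp (w j))) := by
        rw [hZe, Finset.mul_prod_erase _ (fun j => 1 + Real.exp (w j)) (Finset.mem_univ i)]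
      have hP : ∏ j ∈ Finset.univ.erase i, (1 + Real.exp (w j)) ≠ 0 :=
        Finset.prod_ne_zero_iff.2 fun j _ => (hpos j).ne'
      rw [hnum, hden, mul_div_mul_left _ _ (Real.exp_ne_zero c), mul_div_mul_right _ _ hP]
    have hfactor : ∀ i, (if i ∈ s then Real.exp (w i) / (1 + Real.exp (w i))
        else 1 - Real.exp (w i) / (1 + Real.exp (w i)))
        = (if i ∈ s then Real.exp (w i) else 1) / (1 + Real.exp (w i)) := fun i => by
      have := (hpos i).ne'
      split_ifs
      · rfl
      · field_simp
        ring
    simp only [hmarg, hfactor]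
    rw [Finset.prod_div_distrib, Finset.prod_ite_mem, Finset.univ_inter, hqe s, hZe,
      mul_div_mul_left _ _ (Real.exp_ne_zero c)]

theorem state_eq_disjSum (vs : Finset (Fin nx)) (hs : Finset (Fin nh)) :
    state nx nh vs hs = vs.disjSum hs := by
  ext a
  cases a <;> simp [state]

theorem θ_disjSum (p : Finset (Fin nx ⊕ Fin nh) → ℝ) (S : Finset (Fin nx))
    (T : Finset (Fin nh)) :
    θ nx nh p (S.disjSum T) = ∑ J ∈ S.powerset, ∑ L ∈ T.powerset,
      (-1 : ℝ) ^ (S \ J).card * ((-1 : ℝ) ^ (T \ L).card * Real.log (p (state nx nh J L))) := by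
  unfold θ
  rw [← Finset.sum_product']
  refine Finset.sum_bij' (fun K _ => (K.toLeft, K.toRight)) (fun x _ => x.1.disjSum x.2)
    ?_ ?_ ?_ ?_ ?_
  · intro K hK
    rw [Finset.mem_powerset] at hK
    rw [Finset.mem_product, Finset.mem_powerset, Finset.mem_powerset]
    constructor
    · intro i hi
      simpa using hK (Finset.mem_toLeft.1 hi)
    · intro i hi
      simpa using hK (Finset.mem_toRight.1 hi)
  · rintro ⟨J, L⟩ hx
    simp only [Finset.mem_product, Finset.mem_powerset] at hx ⊢
    exact Finset.disjSum_mono hx.1 hx.2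
  · intro K _
    exact Finset.toLeft_disjSum_toRight
  · rintro ⟨J, L⟩ _
    simp
  · intro K _
    have hd : S.disjSum T \ K = (S \ K.toLeft).disjSum (T \ K.toRight) := by
      ext a
      cases a <;> simp
    rw [hd, Finset.card_disjSum, pow_add, state_eq_disjSum, Finset.toLeft_disjSum_toRight]
    ring

theorem θ_disjSum_eq_moebius_left (p : Finset (Fin nx ⊕ Fin nh) → ℝ) (S : Finset (Fin nx))
    (T : Finset (Fin nh)) :
    θ nx nh p (S.disjSum T)
      = moebius (fun L => moebius (fun J => Real.log (p (state nx nh J L))) S) T := by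
  rw [θ_disjSum, Finset.sum_comm]
  simp only [moebius, Finset.mul_sum]
  refine Finset.sum_congr rfl fun L _ => Finset.sum_congr rfl fun J _ => ?_
  ring

theorem θ_disjSum_eq_moebius_right (p : Finset (Fin nx ⊕ Fin nh) → ℝ) (S : Finset (Fin nx))
    (T : Finset (Fin nh)) :
    θ nx nh p (S.disjSum T)
      = moebius (fun J => moebius (fun L => Real.log (p (state nx nh J L))) T) S := by
  rw [θ_disjSum]
  simp only [moebius, Finset.mul_sum]

theorem card_filter_isLeft_disjSum (S : Finset (Fin nx)) (T : Finset (Fin nh)) :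
    ((S.disjSum T).filter (fun a : Fin nx ⊕ Fin nh => a.isLeft = true)).card = S.card := by
  have h : (S.disjSum T).filter (fun a : Fin nx ⊕ Fin nh => a.isLeft = true)
      = S.disjSum ∅ := by
    ext a
    cases a <;> simp
  simp [h]

theorem card_filter_isRight_disjSum (S : Finset (Fin nx)) (T : Finset (Fin nh)) :
    ((S.disjSum T).filter (fun a : Fin nx ⊕ Fin nh => a.isRight = true)).card = T.card := by
  have h : (S.disjSum T).filter (fun a : Fin nx ⊕ Fin nh => a.isRight = true)
      = (∅ : Finset (Fin nx)).disjSum T := by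
    ext a
    cases a <;> simp
  simp [h]

theorem forall_finset_sum_iff {P : Finset (Fin nx ⊕ Fin nh) → Prop} :
    (∀ I, P I) ↔ ∀ (S : Finset (Fin nx)) (T : Finset (Fin nh)), P (S.disjSum T) :=
  ⟨fun h _ _ => h _, fun h I => Finset.toLeft_disjSum_toRight (u := I) ▸ h I.toLeft I.toRight⟩

theorem conditional_independence_iff_theta_vanishes
    (p : Finset (Fin nx ⊕ Fin nh) → ℝ)
    (hpos : ∀ x, 0 < p x) (hsum : ∑ x : Finset (Fin nx ⊕ Fin nh), p x = 1) :
    -- completeness: visible units conditionally independent given hidden units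
    ((∀ (hs : Finset (Fin nh)) (vs : Finset (Fin nx)),
        condVis nx nh p vs hs
          = ∏ i : Fin nx,
              (if i ∈ vs then condVisOne nx nh p i hs
               else 1 - condVisOne nx nh p i hs))
      ↔ (∀ I : Finset (Fin nx ⊕ Fin nh),
          2 ≤ (I.filter (fun a : Fin nx ⊕ Fin nh => a.isLeft = true)).card →
          θ nx nh p I = 0)) ∧
    -- compactness: hidden units conditionally independent given visible units
    ((∀ (vs : Finset (Fin nx)) (hs : Finset (Fin nh)),
        condHid nx nh p hs vs
          = ∏ j : Fin nh,
              (if j ∈ hs then condHidOne nx nh p j vs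
               else 1 - condHidOne nx nh p j vs))
      ↔ (∀ I : Finset (Fin nx ⊕ Fin nh),
          2 ≤ (I.filter (fun a : Fin nx ⊕ Fin nh => a.isRight = true)).card →
          θ nx nh p I = 0)) := by
  constructor
  · rw [forall_finset_sum_iff]
    simp only [card_filter_isLeft_disjSum, θ_disjSum_eq_moebius_left]
    calc _ ↔ ∀ hs, ∀ S : Finset (Fin nx), 2 ≤ S.card →
            moebius (fun J => Real.log (p (state nx nh J hs))) S = 0 :=
          forall_congr' fun hs =>
            (eq_prod_marginals_iff_log_affine (fun vs => p (state nx nh vs hs))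
              fun _ => hpos _).trans (affine_iff_moebius_eq_zero _)
      _ ↔ ∀ S : Finset (Fin nx), 2 ≤ S.card → ∀ hs,
            moebius (fun J => Real.log (p (state nx nh J hs))) S = 0 :=
          ⟨fun h S hS hs => h hs S hS, fun h hs S hS => h S hS hs⟩
      _ ↔ _ := forall_congr' fun S =>
          (imp_congr_right fun _ => (forall_moebius_eq_zero_iff _).symm).trans forall_comm
  · rw [forall_finset_sum_iff]
    simp only [card_filter_isRight_disjSum, θ_disjSum_eq_moebius_right]
    calc _ ↔ ∀ vs, ∀ T : Finset (Fin nh), 2 ≤ T.card →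
            moebius (fun L => Real.log (p (state nx nh vs L))) T = 0 :=
          forall_congr' fun vs =>
            (eq_prod_marginals_iff_log_affine (fun hs => p (state nx nh vs hs))
              fun _ => hpos _).trans (affine_iff_moebius_eq_zero _)
      _ ↔ ∀ T : Finset (Fin nh), 2 ≤ T.card → ∀ vs,
            moebius (fun L => Real.log (p (state nx nh vs L))) T = 0 :=
          ⟨fun h T hT vs => h vs T hT, fun h vs T hT => h T hT vs⟩
      _ ↔ ∀ T : Finset (Fin nh), 2 ≤ T.card → ∀ S,
            moebius (fun J => moebius (fun L => Real.log (p (state nx nh J L))) T) S = 0 :=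
          forall_congr' fun T =>
            imp_congr_right fun _ => (forall_moebius_eq_zero_iff _).symm
      _ ↔ _ := ⟨fun h S T hT => h T hT S, fun h T hT S => h S T hT⟩

end Stmt17
end
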